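/- Let G be a finite discrete group, X a profinite space, and η a continuous free topological partial action of G on X such that the domain G*X is clopen in G × X. Then the quotient map π_G : X → X/∼_G admits a continuous section, i.e. there exists a continuous map q : X/∼_G → X with π_G(q(z)) = z for all z ∈ X/∼_G. -/

import Mathlib

/-- A topological partial action of a topological group `G` on a topological space `X`:
a family of homeomorphisms `η_g : X_{g⁻¹} → X_g` between open subsets of `X`, encoded by
total functions `act g : X → X` whose behaviour only matters on `dom g⁻¹`. -/
structure TopPartialAction (G : Type*) (X : Type*) [Group G] [TopologicalSpace G]
    [TopologicalSpace X] where
  /-- The sets `X_g`; `act g` is a bijection from `dom g⁻¹` onto `dom g`. -/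
  dom : G → Set X
  /-- The partially defined maps `η_g`, as total functions. -/
  act : G → X → X
  dom_one : dom 1 = Set.univ
  act_one : ∀ x : X, act 1 x = x
  isOpen_dom : ∀ g : G, IsOpen (dom g)
  bijOn : ∀ g : G, Set.BijOn (act g) (dom g⁻¹) (dom g)
  continuousOn_act : ∀ g : G, ContinuousOn (act g) (dom g⁻¹)
  image_inter : ∀ g h : G, act g '' (dom g⁻¹ ∩ dom h) = dom g ∩ dom (g * h)
  act_comp : ∀ g h : G, ∀ x ∈ dom h⁻¹ ∩ dom (g * h)⁻¹, act g (act h x) = act (g * h) x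

namespace TopPartialAction

variable {G : Type*} {X : Type*} [Group G] [TopologicalSpace G] [TopologicalSpace X]

/-- The domain `G*X = {(g,x) : x ∈ X_{g⁻¹}}` of the partial action. -/
def pDom (η : TopPartialAction G X) : Set (G × X) := {p : G × X | p.2 ∈ η.dom p.1⁻¹}

/-- The partial action is continuous if `(g,x) ↦ η_g(x)` is continuous on `G*X`. -/
def IsContinuous (η : TopPartialAction G X) : Prop :=
  ContinuousOn (fun p : G × X => η.act p.1 p.2) η.pDom

/-- The partial action is free if `η_g(x) = x` forces `g = 1`. -/
def IsFree (η : TopPartialAction G X) : Prop :=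
  ∀ (g : G) (x : X), x ∈ η.dom g⁻¹ → η.act g x = x → g = 1

/-- The orbit equivalence relation `∼_G` on `X`. -/
def orbitRel (η : TopPartialAction G X) (x y : X) : Prop :=
  ∃ g : G, x ∈ η.dom g⁻¹ ∧ η.act g x = y

end TopPartialAction

namespace TopPartialAction

variable {G : Type*} {X : Type*} [Group G] [TopologicalSpace G] [TopologicalSpace X]

theorem orbitRel_refl' (η : TopPartialAction G X) (x : X) : η.orbitRel x x :=
  ⟨1, by simp [η.dom_one], η.act_one x⟩

theorem orbitRel_symm' (η : TopPartialAction G X) {x y : X} (h : η.orbitRel x y) :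
    η.orbitRel y x := by
  obtain ⟨g, hx, rfl⟩ := h
  refine ⟨g⁻¹, by simpa using (η.bijOn g).mapsTo hx, ?_⟩
  rw [η.act_comp g⁻¹ g x ⟨hx, by simp [η.dom_one]⟩, inv_mul_cancel, η.act_one]

theorem orbitRel_trans' (η : TopPartialAction G X) {x y z : X} (h : η.orbitRel x y)
    (h' : η.orbitRel y z) : η.orbitRel x z := by
  obtain ⟨g, hx, rfl⟩ := h
  obtain ⟨k, hy, rfl⟩ := h'
  have h1 : η.act g x ∈ η.dom g ∩ η.dom (g * (g⁻¹ * k⁻¹)) :=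
    ⟨(η.bijOn g).mapsTo hx, by simpa using hy⟩
  rw [← η.image_inter] at h1
  obtain ⟨x', ⟨h2, h3⟩, h4⟩ := h1
  have : x' = x := (η.bijOn g).injOn h2 hx h4
  subst this
  have h5 : x' ∈ η.dom (k * g)⁻¹ := by simpa using h3
  exact ⟨k * g, h5, (η.act_comp k g x' ⟨hx, h5⟩).symm⟩

/-- Saturation. -/
def sat' (η : TopPartialAction G X) (U : Set X) : Set X := {x | ∃ y ∈ U, η.orbitRel x y}

/-- Meets each orbit at most once. -/
def slim' (η : TopPartialAction G X) (U : Set X) : Prop :=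
  ∀ x ∈ U, ∀ y ∈ U, η.orbitRel x y → x = y

theorem isClopen_dom' [DiscreteTopology G] (η : TopPartialAction G X)
    (hc : IsClopen η.pDom) (g : G) : IsClopen (η.dom g⁻¹) :=
  hc.preimage (f := fun x : X => (g, x)) (by fun_prop)

theorem isClopen_piece' [DiscreteTopology G] (η : TopPartialAction G X)
    (hc : IsClopen η.pDom) (g : G) {U : Set X} (hU : IsClopen U) :
    IsClopen (η.dom g⁻¹ ∩ η.act g ⁻¹' U) :=
  ⟨(η.continuousOn_act g).preimage_isClosed_of_isClosed (η.isClopen_dom' hc g).1 hU.1,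
   (η.continuousOn_act g).isOpen_inter_preimage (η.isClopen_dom' hc g).2 hU.2⟩

theorem isClopen_sat' [Finite G] [DiscreteTopology G] (η : TopPartialAction G X)
    (hc : IsClopen η.pDom) {U : Set X} (hU : IsClopen U) : IsClopen (η.sat' U) := by
  have : η.sat' U = ⋃ g : G, (η.dom g⁻¹ ∩ η.act g ⁻¹' U) := by
    ext x
    simp only [sat', orbitRel, Set.mem_setOf_eq, Set.mem_iUnion, Set.mem_inter_iff,
      Set.mem_preimage]
    constructor
    · rintro ⟨y, hy, g, hg, rfl⟩
      exact ⟨g, hg, hy⟩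
    · rintro ⟨g, hg, hy⟩
      exact ⟨_, hy, g, hg, rfl⟩
  rw [this]
  exact isClopen_iUnion_of_finite fun g => η.isClopen_piece' hc g hU

theorem exists_slim' [Finite G] [DiscreteTopology G] [CompactSpace X]
    [T2Space X] [TotallyDisconnectedSpace X] (η : TopPartialAction G X)
    (hfree : η.IsFree) (hc : IsClopen η.pDom) (x : X) :
    ∃ U : Set X, IsClopen U ∧ x ∈ U ∧ η.slim' U := by
  have key : ∀ g : G, ∃ V : Set X, IsOpen V ∧ x ∈ V ∧
      ∀ y ∈ V, y ∈ η.dom g⁻¹ → η.act g y ∈ V → y = η.act g y := by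
    intro g
    by_cases hg : g = 1
    · subst hg
      exact ⟨Set.univ, isOpen_univ, trivial, fun y _ _ _ => (η.act_one y).symm⟩
    by_cases hx : x ∈ η.dom g⁻¹
    · have hne : η.act g x ≠ x := fun h => hg (hfree g x hx h)
      obtain ⟨A, B, hA, hB, hxA, hxB, hAB⟩ := t2_separation hne
      refine ⟨B ∩ (η.dom g⁻¹ ∩ η.act g ⁻¹' A), hB.inter
        ((η.continuousOn_act g).isOpen_inter_preimage (η.isOpen_dom _) hA),
        ⟨hxB, hx, hxA⟩, fun y hy _ hy' => ?_⟩
      exact (Set.disjoint_left.1 hAB hy.2.2 hy'.1).elim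
    · exact ⟨(η.dom g⁻¹)ᶜ, (η.isClopen_dom' hc g).compl.2, hx, fun y hy hy' => (hy hy').elim⟩
  choose V hV hxV hs using key
  obtain ⟨U, hU, hxU, hUV⟩ := compact_exists_isClopen_in_isOpen
    (isOpen_iInter_of_finite hV) (Set.mem_iInter.2 hxV)
  refine ⟨U, hU, hxU, ?_⟩
  rintro y hy _ hz ⟨g, hg, rfl⟩
  exact hs g y (Set.mem_iInter.1 (hUV hy) g) hg (Set.mem_iInter.1 (hUV hz) g)

theorem exists_transversal' [Finite G] [DiscreteTopology G] [CompactSpace X]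
    [T2Space X] [TotallyDisconnectedSpace X] (η : TopPartialAction G X)
    (hfree : η.IsFree) (hc : IsClopen η.pDom) :
    ∃ T : Set X, IsClopen T ∧ η.slim' T ∧ Set.univ ⊆ η.sat' T := by
  refine isCompact_univ.induction_on
    (p := fun s => ∃ T : Set X, IsClopen T ∧ η.slim' T ∧ s ⊆ η.sat' T) ?_ ?_ ?_ ?_
  · exact ⟨∅, isClopen_empty, fun x hx => hx.elim, Set.empty_subset _⟩
  · rintro s t hst ⟨T, h1, h2, h3⟩
    exact ⟨T, h1, h2, hst.trans h3⟩
  · rintro s t ⟨T, h1, h2, h3⟩ ⟨T', h1', h2', h3'⟩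
    refine ⟨T ∪ (T' \ η.sat' T), h1.union (h1'.diff (η.isClopen_sat' hc h1)), ?_, ?_⟩
    · rintro x (hx | hx) y (hy | hy) hxy
      · exact h2 x hx y hy hxy
      · exact (hy.2 ⟨x, hx, η.orbitRel_symm' hxy⟩).elim
      · exact (hx.2 ⟨y, hy, hxy⟩).elim
      · exact h2' x hx.1 y hy.1 hxy
    · rintro x (hx | hx)
      · obtain ⟨y, hy, hxy⟩ := h3 hx
        exact ⟨y, Or.inl hy, hxy⟩
      · obtain ⟨y, hy, hxy⟩ := h3' hx
        by_cases h : y ∈ η.sat' T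
        · obtain ⟨z, hz, hyz⟩ := h
          exact ⟨z, Or.inl hz, η.orbitRel_trans' hxy hyz⟩
        · exact ⟨y, Or.inr ⟨hy, h⟩, hxy⟩
  · intro x _
    obtain ⟨U, hU, hxU, hs⟩ := η.exists_slim' hfree hc x
    exact ⟨U, mem_nhdsWithin_of_mem_nhds (hU.2.mem_nhds hxU), U, hU, hs,
      fun y hy => ⟨y, hy, η.orbitRel_refl' y⟩⟩

end TopPartialAction

/-- Proposition 3.6: a continuous free partial action of a finite discrete group on a
profinite space with clopen domain; the quotient map `π_G` has a continuous section. -/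
theorem exists_continuous_section_of_finite {G X : Type*} [Group G] [Finite G]
    [TopologicalSpace G] [DiscreteTopology G] [TopologicalSpace X] [CompactSpace X]
    [T2Space X] [TotallyDisconnectedSpace X] (eta : TopPartialAction G X)
    (hcont : eta.IsContinuous) (hfree : eta.IsFree) (hclopen : IsClopen eta.pDom) :
    ∃ q : Quot eta.orbitRel → X, Continuous q ∧ ∀ z, Quot.mk eta.orbitRel (q z) = z := by
  obtain ⟨T, hT, hs, hcov⟩ := eta.exists_transversal' hfree hclopen
  choose r hrT hr using fun x : X => hcov (Set.mem_univ x)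
  have hinv : ∀ x y, eta.orbitRel x y → r x = r y := fun x y h =>
    hs _ (hrT x) _ (hrT y)
      (eta.orbitRel_trans' (eta.orbitRel_symm' (hr x)) (eta.orbitRel_trans' h (hr y)))
  have hrc : Continuous r := by
    rw [continuous_iff_continuousAt]
    intro x
    obtain ⟨g, hg, hgx⟩ := hr x
    have hO := (eta.isClopen_piece' hclopen g hT).2
    have hxO : x ∈ eta.dom g⁻¹ ∩ eta.act g ⁻¹' T := ⟨hg, by
      rw [Set.mem_preimage, hgx]; exact hrT x⟩
    have hca : ContinuousAt (eta.act g) x :=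
      (eta.continuousOn_act g).continuousAt ((eta.isOpen_dom _).mem_nhds hg)
    refine hca.congr ?_
    filter_upwards [hO.mem_nhds hxO] with y hy
    exact hs _ hy.2 _ (hrT y)
      (eta.orbitRel_trans' (eta.orbitRel_symm' ⟨g, hy.1, rfl⟩) (hr y))
  refine ⟨Quot.lift r hinv, continuous_quot_lift hinv hrc, ?_⟩
  rintro ⟨x⟩
  exact (Quot.sound (hr x)).symm
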